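/- Let Ω ⊂ ℝ^N (N ≥ 2) be a smooth bounded open set with (−8,8)^N ⊂ Ω, let n ≥ 1, m ≥ 1 and r be integers with 1 < r ≤ min{n,N}, and let 1 < p < ∞ and 0 < s < ∞ be such that W^{s,p}(Ω,ℝ^n) is not contained in W^{m−m/r,r}(Ω,ℝ^n); equivalently, s − m + m/r < max{0, N/p − N/r}, or (p > r and s = m − m/r is not an integer). Assume moreover that the condition (1 < r < p and s = m − m/r is not an integer) fails. Then there exist a sequence {u_k} ⊂ C^m(Ω̄, ℝ^n), multi-indices β ∈ I(r,n) and 𝛂 = (α^1,…,α^m) with α^j ∈ I(r,N), and a function ψ ∈ C_c^∞(Ω) such that ‖u_k‖_{W^{s,p}(Ω)} → 0 and ∫_Ω M^β_𝛂(D^m u_k) ψ dx → +∞ as k → ∞. -/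

import Mathlib

open MeasureTheory Filter Topology Real

noncomputable section

abbrev Euc (N : ℕ) := EuclideanSpace ℝ (Fin N)

/-- The (full signed) determinant of an `m`-dimensional matrix of order `N^m`:
`det A = ∑_{τ_2,…,τ_m ∈ S_N} (∏_{s=2}^m sgn τ_s) ∏_{k=1}^N a_{k τ_2(k) ⋯ τ_m(k)}`. -/
def hyperDet {N : ℕ} : {m : ℕ} → ((Fin m → Fin N) → ℝ) → ℝ
  | 0, A => A finZeroElim
  | m + 1, A =>
      ∑ τ : Fin m → Equiv.Perm (Fin N),
        (∏ s, ((Equiv.Perm.sign (τ s) : ℤ) : ℝ)) *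
          ∏ k : Fin N, A (Fin.cons k fun s => τ s k)

/-- classical partial derivative `∂_i f`. -/
def pderiv' {N : ℕ} (i : Fin N) (f : Euc N → ℝ) : Euc N → ℝ :=
  fun x => fderiv ℝ f x (EuclideanSpace.single i 1)

/-- iterated partial derivative `∂_{l_1} ∂_{l_2} ⋯ f`. -/
def pderivList {N : ℕ} : List (Fin N) → (Euc N → ℝ) → Euc N → ℝ
  | [], f => f
  | i :: l, f => pderiv' i (pderivList l f)

/-- the `m`th-Jacobian `(β,α)`-minor `M^β_α(D^m u)` of `u : Ω → ℝ^n`, i.e. the hyper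
determinant of the `(m+1)`-dimensional matrix of order `r^{m+1}` with entries
`∂_{α^1_{l_1}} ⋯ ∂_{α^m_{l_m}} u^{β_{l_0}}`. -/
def jacMinor {N n : ℕ} (m r : ℕ) (β : Fin r → Fin n) (α : Fin m → Fin r → Fin N)
    (u : Euc N → Fin n → ℝ) (x : Euc N) : ℝ :=
  hyperDet (m := m + 1) fun l : Fin (m + 1) → Fin r =>
    pderivList (List.ofFn fun s : Fin m => α s (l s.succ)) (fun y => u y (β (l 0))) x

/-- the `m`th-Jacobian `α`-minor `M_α(D^m v)` of a scalar function `v`. -/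
def scalMinor {N : ℕ} (m r : ℕ) (α : Fin m → Fin r → Fin N)
    (v : Euc N → ℝ) (x : Euc N) : ℝ :=
  hyperDet (m := m) fun l : Fin m → Fin r =>
    pderivList (List.ofFn fun s : Fin m => α s (l s)) v x

/-- the integer Sobolev norm `‖u‖_{W^{k,p}(Ω)} = ∑_{j ≤ k} ‖D^j u‖_{L^p(Ω)}`. -/
def intSobNorm {N : ℕ} {F : Type*} [NormedAddCommGroup F] [NormedSpace ℝ F]
    (Ω : Set (Euc N)) (k : ℕ) (p : ℝ) (u : Euc N → F) : ℝ :=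
  ∑ j ∈ Finset.range (k + 1), (∫ x in Ω, ‖iteratedFDeriv ℝ j u x‖ ^ p) ^ (1 / p)

open Classical in
/-- the (possibly fractional) Sobolev norm `‖u‖_{W^{s,p}(Ω)}`: for integer `s` the usual
Sobolev norm, for non-integer `s` the `W^{[s],p}` norm plus the Gagliardo seminorm of
`D^{[s]} u` with fractional exponent `s - [s]`. -/
def sobNorm {N : ℕ} {F : Type*} [NormedAddCommGroup F] [NormedSpace ℝ F]
    (Ω : Set (Euc N)) (s p : ℝ) (u : Euc N → F) : ℝ :=
  if ∃ k : ℕ, s = k then intSobNorm Ω ⌊s⌋₊ p u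
  else
    intSobNorm Ω ⌊s⌋₊ p u +
      (∫ x in Ω, ∫ y in Ω,
          ‖iteratedFDeriv ℝ ⌊s⌋₊ u x - iteratedFDeriv ℝ ⌊s⌋₊ u y‖ ^ p /
            ‖x - y‖ ^ ((N : ℝ) + (s - ⌊s⌋₊) * p)) ^ (1 / p)

/-- `‖D^m ψ‖_{L^∞}`, the sup of the `m`-th derivatives of `ψ`. -/
def supDm {N : ℕ} (m : ℕ) (ψ : Euc N → ℝ) : ℝ := ⨆ x, ‖iteratedFDeriv ℝ m ψ x‖

/-- `ψ ∈ C_c^∞(Ω)`. -/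
def IsCinfc {N : ℕ} (Ω : Set (Euc N)) (ψ : Euc N → ℝ) : Prop :=
  ContDiff ℝ (⊤ : ℕ∞) ψ ∧ HasCompactSupport ψ ∧ tsupport ψ ⊆ Ω

/-- `Ω` is a smooth bounded open subset of `ℝ^N`. -/
def IsSmoothDomain {N : ℕ} (Ω : Set (Euc N)) : Prop :=
  IsOpen Ω ∧ Bornology.IsBounded Ω ∧
    ∃ f : Euc N → ℝ, ContDiff ℝ (⊤ : ℕ∞) f ∧ Ω = {x | f x < 0} ∧
      ∀ x ∈ frontier Ω, fderiv ℝ f x ≠ 0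

/-- A sequence of smooth maps oscillating at frequency at most `k + 1`: the `j`-th derivatives of
the `k`-th map are uniformly `O((k + 1)^j)`. -/
def IsOsc {N : ℕ} {F : Type*} [NormedAddCommGroup F] [NormedSpace ℝ F]
    (f : ℕ → Euc N → F) : Prop :=
  (∀ k, ContDiff ℝ (⊤ : ℕ∞) (f k)) ∧
    ∀ j : ℕ, ∃ C : ℝ, 0 ≤ C ∧ ∀ k x, ‖iteratedFDeriv ℝ j (f k) x‖ ≤ C * ((k : ℝ) + 1) ^ j

section Osc

variable {N : ℕ} {F G : Type*} [NormedAddCommGroup F] [NormedSpace ℝ F]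
  [NormedAddCommGroup G] [NormedSpace ℝ G]

theorem IsOsc.comp_smul {f : G → F} (hf : ContDiff ℝ (⊤ : ℕ∞) f)
    (hb : ∀ j : ℕ, ∃ C : ℝ, ∀ x, ‖iteratedFDeriv ℝ j f x‖ ≤ C) (L : Euc N →L[ℝ] G) :
    IsOsc (fun k x => f (((k : ℝ) + 1) • L x)) := by
  refine ⟨fun k => hf.comp (by fun_prop), fun j => ?_⟩
  obtain ⟨C, hC⟩ := hb j
  have hC0 : 0 ≤ C := (norm_nonneg _).trans (hC 0)
  refine ⟨C * ‖L‖ ^ j, by positivity, fun k x => ?_⟩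
  have h1 := (((k : ℝ) + 1) • L).iteratedFDeriv_comp_right (f := f) hf x (i := j)
    (by exact_mod_cast le_top)
  have h2 : (f ∘ (((k : ℝ) + 1) • L)) = fun x => f (((k : ℝ) + 1) • L x) := rfl
  simp only [← h2]
  rw [h1]
  refine (ContinuousMultilinearMap.norm_compContinuousLinearMap_le _ _).trans ?_
  rw [Finset.prod_const, Finset.card_univ, Fintype.card_fin, norm_smul, mul_pow,
    Real.norm_of_nonneg (by positivity), mul_assoc, mul_comm (‖L‖ ^ j)]
  gcongr
  exact hC _

theorem bounded_iteratedFDeriv {f : G → F} (hf : ContDiff ℝ (⊤ : ℕ∞) f)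
    (hs : HasCompactSupport f) (j : ℕ) : ∃ C : ℝ, ∀ x, ‖iteratedFDeriv ℝ j f x‖ ≤ C :=
  (hs.iteratedFDeriv j).exists_bound_of_continuous
    (hf.continuous_iteratedFDeriv (by exact_mod_cast le_top))

theorem IsOsc.const {f : Euc N → F} (hf : ContDiff ℝ (⊤ : ℕ∞) f)
    (hs : HasCompactSupport f) : IsOsc (fun _ => f) := by
  refine ⟨fun _ => hf, fun j => ?_⟩
  obtain ⟨C, hC⟩ := bounded_iteratedFDeriv hf hs j
  have hC0 : 0 ≤ C := (norm_nonneg _).trans (hC 0)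
  refine ⟨C, hC0, fun k x => (hC x).trans (le_mul_of_one_le_right hC0 (one_le_pow₀ ?_))⟩
  simp

theorem IsOsc.one : IsOsc (fun (_ : ℕ) (_ : Euc N) => (1 : ℝ)) := by
  refine ⟨fun _ => contDiff_const, fun j => ⟨1, zero_le_one, fun k x => ?_⟩⟩
  rcases eq_or_ne j 0 with rfl | hj
  · simp
  · rw [iteratedFDeriv_const_of_ne hj]
    simp
    positivity

theorem IsOsc.mul {f g : ℕ → Euc N → ℝ} (hf : IsOsc f) (hg : IsOsc g) :
    IsOsc (fun k x => f k x * g k x) := by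
  refine ⟨fun k => (hf.1 k).mul (hg.1 k), fun j => ?_⟩
  choose A hA0 hA using hf.2
  choose B hB0 hB using hg.2
  refine ⟨∑ i ∈ Finset.range (j + 1), (j.choose i : ℝ) * A i * B (j - i),
    Finset.sum_nonneg fun i _ =>
      mul_nonneg (mul_nonneg (Nat.cast_nonneg _) (hA0 _)) (hB0 _), fun k x => ?_⟩
  refine (norm_iteratedFDeriv_mul_le (hf.1 k) (hg.1 k) x (n := j)
    (by exact_mod_cast le_top)).trans ?_
  rw [Finset.sum_mul]
  refine Finset.sum_le_sum fun i hi => ?_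
  have hij : i + (j - i) = j := by
    have := Finset.mem_range.1 hi
    omega
  calc (j.choose i : ℝ) * ‖iteratedFDeriv ℝ i (f k) x‖ * ‖iteratedFDeriv ℝ (j - i) (g k) x‖
      ≤ (j.choose i : ℝ) * (A i * ((k : ℝ) + 1) ^ i) * (B (j - i) * ((k : ℝ) + 1) ^ (j - i)) := by
        have := hA0 i
        gcongr
        · exact hA i k x
        · exact hB (j - i) k x
    _ = (j.choose i : ℝ) * A i * B (j - i) * ((k : ℝ) + 1) ^ (i + (j - i)) := by ring
    _ = _ := by rw [hij]

theorem IsOsc.prod {ι : Type*} (s : Finset ι) {f : ι → ℕ → Euc N → ℝ}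
    (hf : ∀ i ∈ s, IsOsc (f i)) : IsOsc (fun k x => ∏ i ∈ s, f i k x) := by
  classical
  induction s using Finset.induction_on with
  | empty => simpa using IsOsc.one
  | insert a s ha ih =>
    simp only [Finset.prod_insert ha]
    exact (hf a (Finset.mem_insert_self _ _)).mul
      (ih fun i hi => hf i (Finset.mem_insert_of_mem hi))

theorem IsOsc.sum {ι : Type*} (s : Finset ι) {f : ι → ℕ → Euc N → F}
    (hf : ∀ i ∈ s, IsOsc (f i)) : IsOsc (fun k x => ∑ i ∈ s, f i k x) := by
  refine ⟨fun k => ContDiff.sum fun i hi => (hf i hi).1 k, fun j => ?_⟩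
  have : ∀ i, ∃ C : ℝ, 0 ≤ C ∧ (i ∈ s →
      ∀ k x, ‖iteratedFDeriv ℝ j (f i k) x‖ ≤ C * ((k : ℝ) + 1) ^ j) := fun i => by
    by_cases hi : i ∈ s
    · obtain ⟨C, h0, h⟩ := (hf i hi).2 j
      exact ⟨C, h0, fun _ => h⟩
    · exact ⟨0, le_rfl, fun h => absurd h hi⟩
  choose C h0 hC using this
  refine ⟨∑ i ∈ s, C i, Finset.sum_nonneg fun i _ => h0 i, fun k x => ?_⟩
  rw [iteratedFDeriv_sum (f := fun i => f i k)
    fun i hi => ((hf i hi).1 k).of_le (by exact_mod_cast le_top), Finset.sum_apply, Finset.sum_mul]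
  exact (norm_sum_le _ _).trans (Finset.sum_le_sum fun i hi => hC i hi k x)

theorem IsOsc.clm_comp {f : ℕ → Euc N → F} (hf : IsOsc f) (L : F →L[ℝ] G) :
    IsOsc (fun k x => L (f k x)) := by
  refine ⟨fun k => L.contDiff.comp (hf.1 k), fun j => ?_⟩
  obtain ⟨C, h0, hC⟩ := hf.2 j
  refine ⟨‖L‖ * C, by positivity, fun k x => ?_⟩
  refine (L.norm_iteratedFDeriv_comp_left (f := f k) ((hf.1 k).contDiffAt (x := x))
    (n := j) (N := (⊤ : ℕ∞)) (by exact_mod_cast le_top)).trans ?_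
  rw [mul_assoc]
  gcongr
  exact hC k x

theorem IsOsc.pi {n : ℕ} {f : ℕ → Euc N → Fin n → ℝ} (hf : ∀ i, IsOsc fun k x => f k x i) :
    IsOsc f := by
  have := IsOsc.sum Finset.univ (f := fun i k x =>
    ContinuousLinearMap.single ℝ (fun _ : Fin n => ℝ) i (f k x i)) fun i _ => (hf i).clm_comp _
  convert this using 3 with k x
  ext i
  simp [Finset.sum_apply, Pi.single_apply]

end Osc

section Norm

open scoped ENNReal

theorem integral_le_of_lintegral_enorm_le {X : Type*} [MeasurableSpace X] {μ : Measure X}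
    {f : X → ℝ} {B : ℝ} (hB : 0 ≤ B) (h : ∫⁻ x, ‖f x‖ₑ ∂μ ≤ ENNReal.ofReal B) :
    ∫ x, f x ∂μ ≤ B := by
  have h1 := (enorm_integral_le_lintegral_enorm f).trans h
  rw [Real.enorm_eq_ofReal_abs, ENNReal.ofReal_le_ofReal_iff hB] at h1
  exact (le_abs_self _).trans h1

theorem tendsto_rpow_inv_of_le {I : ℕ → ℝ} {C e p : ℝ} (hp : 0 < p) (he : e < 0)
    (h0 : ∀ k, 0 ≤ I k) (hI : ∀ k, I k ≤ C * ((k : ℝ) + 1) ^ e) :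
    Tendsto (fun k => I k ^ (1 / p)) atTop (𝓝 0) := by
  have h1 : Tendsto (fun k : ℕ => C * ((k : ℝ) + 1) ^ e) atTop (𝓝 0) := by
    have h2 : Tendsto (fun k : ℕ => (k : ℝ) + 1) atTop atTop :=
      tendsto_atTop_add_const_right _ _ tendsto_natCast_atTop_atTop
    have h3 := (tendsto_rpow_neg_atTop (y := -e) (by linarith)).comp h2
    simpa using h3.const_mul C
  have h2 : Tendsto I atTop (𝓝 0) := squeeze_zero h0 hI h1
  have hp' : 0 < 1 / p := by positivity
  rw [← Real.zero_rpow hp'.ne']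
  exact h2.rpow_const (p := 1 / p) (Or.inr hp'.le)

variable {N : ℕ} {F : Type*} [NormedAddCommGroup F] [NormedSpace ℝ F]

theorem lintegral_riesz_lt_top (hN : 1 ≤ N) {δ : ℝ} (hδ : 0 < δ) (R : ℝ) :
    ∫⁻ z : Euc N, (Metric.ball (0 : Euc N) R).indicator
      (fun z => ENNReal.ofReal (‖z‖ ^ (δ - N))) z < ∞ := by
  have : Nontrivial (Euc N) := by
    have : Nonempty (Fin N) := ⟨⟨0, hN⟩⟩
    infer_instance
  rw [lintegral_indicator Metric.isOpen_ball.measurableSet]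
  have h : IntegrableOn (fun z : Euc N => ‖z‖ ^ (δ - N)) (Metric.ball 0 R) := by
    rw [integrableOn_fun_norm_addHaar volume (f := fun y : ℝ => y ^ (δ - N))]
    have h1 : IntegrableOn (fun y : ℝ => y ^ (δ - 1)) (Set.Ioo 0 R) := by
      rcases le_or_gt R 0 with hR | hR
      · simp [Set.Ioo_eq_empty_of_le hR]
      · have := (intervalIntegral.intervalIntegrable_rpow' (a := 0) (b := R) (r := δ - 1)
          (by linarith))
        rw [intervalIntegrable_iff_integrableOn_Ioo_of_le hR.le] at this
        exact this
    refine h1.congr_fun (fun y hy => ?_) measurableSet_Ioo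
    simp only [finrank_euclideanSpace, Fintype.card_fin, smul_eq_mul]
    rw [← Real.rpow_natCast, ← Real.rpow_add hy.1, Nat.cast_sub hN]
    congr 1
    push_cast
    ring
  exact (hasFiniteIntegral_iff_ofReal
    (Eventually.of_forall fun z => Real.rpow_nonneg (norm_nonneg z) _)).1 h.2

theorem lintegral_lintegral_indicator_le {Ω E : Set (Euc N)}
    (hE : MeasurableSet E) {κ : Euc N → ℝ≥0∞} (hκ : Measurable κ) :
    ∫⁻ x in Ω, ∫⁻ y in Ω, (E.indicator 1 x + E.indicator 1 y) * κ (x - y) ≤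
      2 * (volume (E ∩ Ω) * ∫⁻ z, κ z) := by
  have hm : Measurable (E.indicator (1 : Euc N → ℝ≥0∞)) := measurable_one.indicator hE
  have hE1 : ∫⁻ x in Ω, E.indicator (1 : Euc N → ℝ≥0∞) x = volume (E ∩ Ω) := by
    rw [lintegral_indicator_one hE, Measure.restrict_apply hE]
  have h1 : ∫⁻ x in Ω, ∫⁻ y in Ω, E.indicator (1 : Euc N → ℝ≥0∞) x * κ (x - y) ≤
      volume (E ∩ Ω) * ∫⁻ z, κ z := by
    rw [← hE1, ← lintegral_mul_const _ hm]
    refine lintegral_mono fun x => ?_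
    rw [lintegral_const_mul _ (by fun_prop)]
    refine mul_le_mul' le_rfl ?_
    refine (setLIntegral_le_lintegral _ _).trans_eq ?_
    exact lintegral_sub_left_eq_self κ x
  have h2 : ∫⁻ x in Ω, ∫⁻ y in Ω, E.indicator (1 : Euc N → ℝ≥0∞) y * κ (x - y) ≤
      volume (E ∩ Ω) * ∫⁻ z, κ z := by
    rw [lintegral_lintegral_swap (Measurable.aemeasurable (by fun_prop)),
      ← hE1, ← lintegral_mul_const _ hm]
    refine lintegral_mono fun x => ?_
    rw [lintegral_const_mul _ (by fun_prop)]
    refine mul_le_mul' le_rfl ?_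
    refine (setLIntegral_le_lintegral _ _).trans_eq ?_
    exact lintegral_sub_right_eq_self κ x
  simp only [add_mul]
  calc _ = ∫⁻ x in Ω, ((∫⁻ y in Ω, E.indicator (1 : Euc N → ℝ≥0∞) x * κ (x - y)) +
        ∫⁻ y in Ω, E.indicator (1 : Euc N → ℝ≥0∞) y * κ (x - y)) :=
        lintegral_congr fun x => lintegral_add_left (by fun_prop) _
    _ = _ := lintegral_add_left (Measurable.lintegral_prod_right (by fun_prop)) _
    _ ≤ _ := by
      rw [two_mul]
      exact add_le_add h1 h2

theorem norm_sub_le_holder {E : Type*} [NormedAddCommGroup E] [NormedSpace ℝ E] {D : E → F}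
    {A K θ : ℝ} (hA : 0 ≤ A) (hK : 0 < K) (hθ0 : 0 < θ) (hθ1 : θ ≤ 1)
    (hd : Differentiable ℝ D) (hb : ∀ x, ‖D x‖ ≤ A) (hb' : ∀ x, ‖fderiv ℝ D x‖ ≤ A * K)
    (x y : E) : ‖D x - D y‖ ≤ 2 * A * (K * ‖x - y‖) ^ θ := by
  have hnn : 0 ≤ K * ‖x - y‖ := by positivity
  rcases le_total (K * ‖x - y‖) 1 with h | h
  · have h1 : ‖D x - D y‖ ≤ A * K * ‖x - y‖ :=
      convex_univ.norm_image_sub_le_of_norm_fderiv_le (fun z _ => hd z)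
        (fun z _ => hb' z) (Set.mem_univ y) (Set.mem_univ x)
    have h2 : K * ‖x - y‖ ≤ (K * ‖x - y‖) ^ θ := by
      rcases hnn.eq_or_lt with h0 | h0
      · rw [← h0]
        exact Real.rpow_nonneg le_rfl _
      · simpa using Real.rpow_le_rpow_of_exponent_ge h0 h hθ1
    have h3 : 0 ≤ A * (K * ‖x - y‖) ^ θ := by positivity
    nlinarith [mul_le_mul_of_nonneg_left h2 hA]
  · have h1 : 1 ≤ (K * ‖x - y‖) ^ θ := Real.one_le_rpow h hθ0.le
    have h2 : ‖D x - D y‖ ≤ 2 * A := by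
      have := norm_sub_le (D x) (D y)
      linarith [hb x, hb y]
    exact h2.trans (le_mul_of_one_le_right (by positivity) h1)


omit [NormedSpace ℝ F] in
theorem gagliardo_integral_le {Ω E : Set (Euc N)} (hN : 1 ≤ N) (hΩ : MeasurableSet Ω)
    (hE : MeasurableSet E) {R : ℝ} (hR : ∀ x ∈ Ω, ∀ y ∈ Ω, ‖x - y‖ < R)
    {D : Euc N → F} {B V p σ θ : ℝ} (hp : 0 < p) (hσ : σ < θ) (hB : 0 ≤ B) (hV : 0 ≤ V)
    (hvol : volume (E ∩ Ω) ≤ ENNReal.ofReal V)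
    (hD : ∀ x y, ‖D x - D y‖ ≤ B * ‖x - y‖ ^ θ) (hD0 : ∀ x, x ∉ E → D x = 0) :
    ∫ x in Ω, ∫ y in Ω, ‖D x - D y‖ ^ p / ‖x - y‖ ^ ((N : ℝ) + σ * p) ≤
      2 * (∫⁻ z : Euc N, (Metric.ball (0 : Euc N) R).indicator
        (fun z => ENNReal.ofReal (‖z‖ ^ ((θ - σ) * p - N))) z).toReal * (B ^ p * V) := by
  set κ : Euc N → ℝ≥0∞ := (Metric.ball (0 : Euc N) R).indicator
        (fun z => ENNReal.ofReal (‖z‖ ^ ((θ - σ) * p - N))) with hκdef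
  have hκ : Measurable κ :=
    Measurable.indicator (by fun_prop) Metric.isOpen_ball.measurableSet
  have hκtop : ∫⁻ z, κ z < ∞ :=
    lintegral_riesz_lt_top hN (mul_pos (sub_pos.2 hσ) hp) R
  have hpt : ∀ x ∈ Ω, ∀ y ∈ Ω, ‖‖D x - D y‖ ^ p / ‖x - y‖ ^ ((N : ℝ) + σ * p)‖ₑ ≤
      ENNReal.ofReal (B ^ p) * ((E.indicator 1 x + E.indicator 1 y) * κ (x - y)) := by
    intro x hx y hy
    by_cases hz : x ∉ E ∧ y ∉ E
    · rw [hD0 x hz.1, hD0 y hz.2]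
      simp [Real.zero_rpow hp.ne']
    rcases eq_or_ne x y with rfl | hxy
    · simp [Real.zero_rpow hp.ne']
    have h1 : (1 : ℝ≥0∞) ≤ E.indicator 1 x + E.indicator 1 y := by
      by_cases hxE : x ∈ E
      · simp [hxE]
      · have hyE : y ∈ E := by
          by_contra h
          exact hz ⟨hxE, h⟩
        simp [hyE]
    have hmem : x - y ∈ Metric.ball (0 : Euc N) R := by
      simpa using hR x hx y hy
    have ht : 0 < ‖x - y‖ := norm_pos_iff.2 (sub_ne_zero.2 hxy)
    have h2 : ‖D x - D y‖ ^ p / ‖x - y‖ ^ ((N : ℝ) + σ * p) ≤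
        B ^ p * ‖x - y‖ ^ ((θ - σ) * p - N) := by
      have h3 : ‖D x - D y‖ ^ p ≤ B ^ p * ‖x - y‖ ^ (θ * p) := by
        refine (Real.rpow_le_rpow (norm_nonneg _) (hD x y) hp.le).trans_eq ?_
        rw [Real.mul_rpow hB (by positivity), ← Real.rpow_mul ht.le]
      rw [div_le_iff₀ (by positivity), mul_assoc, ← Real.rpow_add ht]
      rwa [show (θ - σ) * p - N + ((N : ℝ) + σ * p) = θ * p by ring]
    rw [Real.enorm_eq_ofReal (by positivity)]
    calc _ ≤ ENNReal.ofReal (B ^ p * ‖x - y‖ ^ ((θ - σ) * p - N)) :=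
          ENNReal.ofReal_le_ofReal h2
      _ = ENNReal.ofReal (B ^ p) * (1 * κ (x - y)) := by
          rw [ENNReal.ofReal_mul (by positivity), one_mul, hκdef, Set.indicator_of_mem hmem]
      _ ≤ _ := by gcongr
  have hB' : ENNReal.ofReal (B ^ p) * (2 * (ENNReal.ofReal V * ∫⁻ z, κ z)) =
      ENNReal.ofReal (2 * (∫⁻ z, κ z).toReal * (B ^ p * V)) := by
    rw [ENNReal.ofReal_mul (by positivity), ENNReal.ofReal_mul (by positivity),
      ENNReal.ofReal_mul (by positivity), ENNReal.ofReal_toReal hκtop.ne]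
    simp only [ENNReal.ofReal_ofNat]
    ring
  refine integral_le_of_lintegral_enorm_le (by positivity) ?_
  rw [← hB']
  calc _ ≤ ∫⁻ x in Ω, ∫⁻ y in Ω, ENNReal.ofReal (B ^ p) *
        ((E.indicator 1 x + E.indicator 1 y) * κ (x - y)) := by
        refine setLIntegral_mono' hΩ fun x hx => ?_
        refine (enorm_integral_le_lintegral_enorm _).trans ?_
        exact setLIntegral_mono' hΩ fun y hy => hpt x hx y hy
    _ = ENNReal.ofReal (B ^ p) * ∫⁻ x in Ω, ∫⁻ y in Ω,
        ((E.indicator 1 x + E.indicator 1 y) * κ (x - y)) := by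
        rw [← lintegral_const_mul' _ _ ENNReal.ofReal_ne_top]
        refine lintegral_congr fun x => ?_
        rw [← lintegral_const_mul' _ _ ENNReal.ofReal_ne_top]
    _ ≤ _ := by
        refine mul_le_mul' le_rfl ((lintegral_lintegral_indicator_le hE hκ).trans ?_)
        gcongr

omit [NormedSpace ℝ F] in
theorem integral_norm_rpow_le {Ω E : Set (Euc N)} (hE : MeasurableSet E)
    {D : Euc N → F} {A V p : ℝ} (hp : 0 < p) (hV : 0 ≤ V) (hA : 0 ≤ A)
    (hvol : volume (E ∩ Ω) ≤ ENNReal.ofReal V)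
    (hD : ∀ x, ‖D x‖ ≤ A) (hD0 : ∀ x, x ∉ E → D x = 0) :
    ∫ x in Ω, ‖D x‖ ^ p ≤ A ^ p * V := by
  refine integral_le_of_lintegral_enorm_le (by positivity) ?_
  calc _ ≤ ∫⁻ x in Ω, E.indicator (fun _ => ENNReal.ofReal (A ^ p)) x := by
        refine lintegral_mono fun x => ?_
        by_cases hx : x ∈ E
        · rw [Set.indicator_of_mem hx, Real.enorm_eq_ofReal (by positivity)]
          exact ENNReal.ofReal_le_ofReal (Real.rpow_le_rpow (norm_nonneg _) (hD x) hp.le)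
        · simp [hD0 x hx, Real.zero_rpow hp.ne']
    _ = ENNReal.ofReal (A ^ p) * volume (E ∩ Ω) := by
        rw [lintegral_indicator_const hE, Measure.restrict_apply hE]
    _ ≤ _ := by
        rw [ENNReal.ofReal_mul (by positivity)]
        gcongr

theorem IsOsc.tendsto_sobNorm (hN : 1 ≤ N) {Ω : Set (Euc N)} (hΩ : IsOpen Ω)
    (hΩb : Bornology.IsBounded Ω) {f : ℕ → Euc N → F} (hf : IsOsc f) {E : ℕ → Set (Euc N)}
    (hE : ∀ k, IsClosed (E k)) (hfE : ∀ k x, x ∉ E k → f k x = 0) {V d a s p : ℝ}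
    (hV : 0 ≤ V) (hvol : ∀ k : ℕ, volume (E k ∩ Ω) ≤ ENNReal.ofReal (V * ((k : ℝ) + 1) ^ (-d)))
    (hp : 0 < p) (hs : 0 < s) (hsa : s < a + d / p) :
    Tendsto (fun k : ℕ => sobNorm Ω s p (fun x => ((k : ℝ) + 1) ^ (-a) • f k x)) atTop (𝓝 0) := by
  choose C hC0 hC using hf.2
  have hK : ∀ k : ℕ, (0 : ℝ) < (k : ℝ) + 1 := fun k => by positivity
  set u : ℕ → Euc N → F := fun k x => ((k : ℝ) + 1) ^ (-a) • f k x with hu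
  have hcd : ∀ k, ContDiff ℝ (⊤ : ℕ∞) (u k) := fun k => (hf.1 k).const_smul _
  have hbd : ∀ j k x, ‖iteratedFDeriv ℝ j (u k) x‖ ≤ C j * ((k : ℝ) + 1) ^ ((j : ℝ) - a) := by
    intro j k x
    have h1 : iteratedFDeriv ℝ j (u k) x = ((k : ℝ) + 1) ^ (-a) • iteratedFDeriv ℝ j (f k) x :=
      iteratedFDeriv_const_smul_apply ((hf.1 k).contDiffAt.of_le (by exact_mod_cast le_top))
    have hpow : 0 ≤ ((k : ℝ) + 1) ^ (-a) := (Real.rpow_pos_of_pos (hK k) _).le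
    rw [h1, norm_smul, Real.norm_of_nonneg hpow]
    refine (mul_le_mul_of_nonneg_left (hC j k x) hpow).trans_eq ?_
    rw [sub_eq_add_neg, Real.rpow_add (hK k), Real.rpow_natCast]
    ring
  have hz : ∀ j k x, x ∉ E k → iteratedFDeriv ℝ j (u k) x = 0 := by
    intro j k x hx
    have h1 : u k =ᶠ[𝓝 x] fun _ => (0 : F) := by
      filter_upwards [(hE k).isOpen_compl.mem_nhds hx] with y hy
      simp [hu, hfE k y hy]
    rw [(h1.iteratedFDeriv ℝ j).eq_of_nhds]
    simp
  have hs0 : (⌊s⌋₊ : ℝ) ≤ s := Nat.floor_le hs.le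
  have hint : Tendsto (fun k => intSobNorm Ω ⌊s⌋₊ p (u k)) atTop (𝓝 0) := by
    have : Tendsto (fun k => intSobNorm Ω ⌊s⌋₊ p (u k)) atTop
        (𝓝 (∑ j ∈ Finset.range (⌊s⌋₊ + 1), 0)) := by
      refine tendsto_finsetSum _ fun j hj => ?_
      have hjs : (j : ℝ) ≤ s := le_trans
        (by exact_mod_cast Nat.lt_succ_iff.1 (Finset.mem_range.1 hj)) hs0
      refine tendsto_rpow_inv_of_le (C := C j ^ p * V) (e := ((j : ℝ) - a) * p - d) hp ?_
        (fun k => integral_nonneg fun x => by positivity) fun k => ?_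
      · have : d / p * p = d := div_mul_cancel₀ _ hp.ne'
        nlinarith
      · refine (integral_norm_rpow_le (hE k).measurableSet hp ?_ ?_ (hvol k) (hbd j k)
          (hz j k)).trans_eq ?_
        · have := hK k
          positivity
        · have := hC0 j
          have := hK k
          positivity
        · rw [Real.mul_rpow (hC0 j) (Real.rpow_nonneg (hK k).le _), ← Real.rpow_mul (hK k).le,
            sub_eq_add_neg (((j : ℝ) - a) * p), Real.rpow_add (hK k)]
          ring
    simpa using this
  by_cases hsint : ∃ k : ℕ, s = k
  · simpa only [sobNorm, if_pos hsint] using hint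
  simp only [sobNorm, if_neg hsint]
  rw [← add_zero (0 : ℝ)]
  refine hint.add ?_
  set J := ⌊s⌋₊ with hJ
  have hJs : (J : ℝ) < s := lt_of_le_of_ne hs0 fun h => hsint ⟨J, h.symm⟩
  have hJ1 : s < J + 1 := Nat.lt_floor_add_one s
  obtain ⟨t, ht1, ht2⟩ := exists_between (lt_min hJ1 hsa)
  obtain ⟨R, hR⟩ := hΩb.exists_norm_le
  set A : ℝ := max (C J) (C (J + 1)) with hA
  have hA0 : 0 ≤ A := (hC0 J).trans (le_max_left _ _)
  set θ : ℝ := t - J with hθ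
  have hθ1 : θ ≤ 1 := by linarith [ht2.trans_le (min_le_left _ _)]
  have hθ0 : 0 < θ := by linarith
  have hta : t < a + d / p := ht2.trans_le (min_le_right _ _)
  have hol : ∀ k x y, ‖iteratedFDeriv ℝ J (u k) x - iteratedFDeriv ℝ J (u k) y‖ ≤
      2 * A * ((k : ℝ) + 1) ^ (t - a) * ‖x - y‖ ^ θ := by
    intro k x y
    have hpow : 0 ≤ ((k : ℝ) + 1) ^ ((J : ℝ) - a) := (Real.rpow_pos_of_pos (hK k) _).le
    refine (norm_sub_le_holder (A := A * ((k : ℝ) + 1) ^ ((J : ℝ) - a)) (K := (k : ℝ) + 1)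
      (mul_nonneg hA0 hpow) (hK k) hθ0 hθ1
      ((hcd k).differentiable_iteratedFDeriv (by exact_mod_cast ENat.natCast_lt_top J))
      (fun z => (hbd J k z).trans ?_) (fun z => ?_) x y).trans_eq ?_
    · gcongr
      exact le_max_left _ _
    · rw [norm_fderiv_iteratedFDeriv]
      refine (hbd (J + 1) k z).trans ?_
      rw [mul_assoc, ← Real.rpow_add_one (hK k).ne']
      push_cast
      rw [show (J : ℝ) - a + 1 = J + 1 - a by ring]
      have hpow : 0 ≤ ((k : ℝ) + 1) ^ ((J : ℝ) + 1 - a) := (Real.rpow_pos_of_pos (hK k) _).le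
      gcongr
      exact le_max_right _ _
    · rw [Real.mul_rpow (hK k).le (norm_nonneg _),
        show t - a = ((J : ℝ) - a) + θ by rw [hθ]; ring, Real.rpow_add (hK k)]
      ring
  refine tendsto_rpow_inv_of_le (C := 2 * (∫⁻ z : Euc N,
      (Metric.ball (0 : Euc N) (2 * R + 1)).indicator
      (fun z => ENNReal.ofReal (‖z‖ ^ ((θ - (s - J)) * p - N))) z).toReal * ((2 * A) ^ p * V))
    (e := (t - a) * p - d) hp ?_
    (fun k => integral_nonneg fun x => integral_nonneg fun y => by positivity) fun k => ?_
  · have : d / p * p = d := div_mul_cancel₀ _ hp.ne'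
    nlinarith
  · have hpow : 0 ≤ ((k : ℝ) + 1) ^ (t - a) := (Real.rpow_pos_of_pos (hK k) _).le
    refine (gagliardo_integral_le hN hΩ.measurableSet (hE k).measurableSet
      (R := 2 * R + 1) (fun x hx y hy => ?_) hp (by linarith)
      (mul_nonneg (by positivity) hpow) ?_ (hvol k) (hol k) (hz J k)).trans_eq ?_
    · linarith [norm_sub_le x y, hR x hx, hR y hy]
    · have := hK k
      positivity
    · rw [Real.mul_rpow (by positivity) hpow, ← Real.rpow_mul (hK k).le,
        sub_eq_add_neg ((t - a) * p), Real.rpow_add (hK k)]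
      ring

end Norm

section Minor

variable {N n m r : ℕ}

theorem pderivList_congr {f g : Euc N → ℝ} {x : Euc N} (h : f =ᶠ[𝓝 x] g) (L : List (Fin N)) :
    pderivList L f =ᶠ[𝓝 x] pderivList L g := by
  induction L with
  | nil => exact h
  | cons i L ih =>
    filter_upwards [ih.fderiv (𝕜 := ℝ)] with y hy
    simp [pderivList, pderiv', hy]

theorem pderivList_zero (L : List (Fin N)) : pderivList L (fun _ => (0 : ℝ)) = fun _ => 0 := by
  induction L with
  | nil => rfl
  | cons i L ih =>
    funext y
    simp [pderivList, pderiv', ih]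

theorem contDiff_pderivList {f : Euc N → ℝ} (hf : ContDiff ℝ (⊤ : ℕ∞) f) (L : List (Fin N)) :
    ContDiff ℝ (⊤ : ℕ∞) (pderivList L f) := by
  induction L with
  | nil => exact hf
  | cons i L ih =>
    exact (ih.fderiv_right (m := (⊤ : ℕ∞)) (by simp)).clm_apply contDiff_const

theorem pderiv_comp_apply {h : ℝ → ℝ} (hh : Differentiable ℝ h) (i k : Fin N) :
    pderiv' i (fun y : Euc N => h (y k)) = fun y => if i = k then deriv h (y k) else 0 := by
  funext y
  have h1 : HasFDerivAt (fun y : Euc N => y k)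
      (EuclideanSpace.proj k : Euc N →L[ℝ] ℝ) y :=
    (EuclideanSpace.proj k : Euc N →L[ℝ] ℝ).hasFDerivAt
  have h2 := (hh (y k)).hasDerivAt.comp_hasFDerivAt y h1
  have h3 : (fun y : Euc N => h (y k)) = h ∘ fun y : Euc N => y k := rfl
  simp only [pderiv']
  rw [h3, h2.fderiv]
  by_cases hik : i = k
  · subst hik
    simp
  · simp [hik, Ne.symm hik]

theorem pderivList_comp_apply {g : ℝ → ℝ} (hg : ContDiff ℝ (⊤ : ℕ∞) g) (k : Fin N)
    (L : List (Fin N)) : pderivList L (fun y : Euc N => g (y k)) =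
      fun y => if ∀ i ∈ L, i = k then iteratedDeriv L.length g (y k) else 0 := by
  induction L with
  | nil => simp [pderivList]
  | cons i L ih =>
    simp only [pderivList, ih, List.forall_mem_cons, List.length_cons]
    by_cases hL : ∀ i ∈ L, i = k
    · simp only [if_pos hL]
      rw [pderiv_comp_apply (hg.differentiable_iteratedDeriv _
        (by exact_mod_cast ENat.natCast_lt_top _))]
      funext y
      simp [iteratedDeriv_succ, eq_true hL]
    · simp only [hL, and_false, if_false]
      funext y
      simp [pderiv']

theorem jacMinor_eq_sum (β : Fin r → Fin n) (α : Fin m → Fin r → Fin N)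
    (u : Euc N → Fin n → ℝ) (x : Euc N) :
    jacMinor m r β α u x = ∑ τ : Fin m → Equiv.Perm (Fin r),
      (∏ s, ((Equiv.Perm.sign (τ s) : ℤ) : ℝ)) *
        ∏ k : Fin r, pderivList (List.ofFn fun s => α s (τ s k)) (fun y => u y (β k)) x := by
  simp [jacMinor, hyperDet]

theorem jacMinor_eq_zero (β : Fin r → Fin n) (α : Fin m → Fin r → Fin N)
    {u : Euc N → Fin n → ℝ} {x : Euc N} (k : Fin r)
    (h : (fun y => u y (β k)) =ᶠ[𝓝 x] fun _ => 0) : jacMinor m r β α u x = 0 := by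
  rw [jacMinor_eq_sum]
  refine Finset.sum_eq_zero fun τ _ => ?_
  rw [Finset.prod_eq_zero (Finset.mem_univ k), mul_zero]
  rw [(pderivList_congr h _).eq_of_nhds, pderivList_zero]

/-- If all the components but one depend near `x` only on their own variable, then the Jacobian
minor at `x` is the product of the pure derivatives. -/
theorem jacMinor_eq_prod (hrN : r ≤ N) (β : Fin r → Fin n) {u : Euc N → Fin n → ℝ} {x : Euc N}
    (l : Fin r) {g : Fin r → ℝ → ℝ} (hg : ∀ k, ContDiff ℝ (⊤ : ℕ∞) (g k))
    (h : ∀ k, k ≠ l → (fun y => u y (β k)) =ᶠ[𝓝 x] fun y => g k (y (Fin.castLE hrN k))) :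
    jacMinor m r β (fun _ => Fin.castLE hrN) u x =
      (∏ k ∈ Finset.univ.erase l, iteratedDeriv m (g k) (x (Fin.castLE hrN k))) *
        pderivList (List.replicate m (Fin.castLE hrN l)) (fun y => u y (β l)) x := by
  have key : ∀ k, k ≠ l → ∀ L : List (Fin N), pderivList L (fun y => u y (β k)) x =
      if ∀ i ∈ L, i = Fin.castLE hrN k then
        iteratedDeriv L.length (g k) (x (Fin.castLE hrN k)) else 0 := fun k hk L => by
    rw [(pderivList_congr (h k hk) _).eq_of_nhds, pderivList_comp_apply (hg k)]
  rw [jacMinor_eq_sum, Finset.sum_eq_single 1]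
  · simp only [Pi.one_apply, Equiv.Perm.sign_one, Units.val_one, Int.cast_one,
      Finset.prod_const_one, one_mul, Equiv.Perm.one_apply, List.ofFn_const]
    rw [← Finset.prod_erase_mul _ _ (Finset.mem_univ l)]
    congr 1
    refine Finset.prod_congr rfl fun k hk => ?_
    rw [key k (Finset.ne_of_mem_erase hk), if_pos (fun i hi => List.eq_of_mem_replicate hi),
      List.length_replicate]
  · intro τ _ hτ
    have : ∃ k, k ≠ l ∧ ∃ s, τ s k ≠ k := by
      by_contra! hcon
      refine hτ (funext fun s => Equiv.ext fun k => ?_)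
      by_cases hk : k = l
      · subst hk
        by_contra hne
        have h1 : τ s k ≠ k := hne
        exact h1 ((τ s).injective (hcon _ h1 s))
      · exact hcon k hk s
    obtain ⟨k, hk, s, hs⟩ := this
    rw [Finset.prod_eq_zero (Finset.mem_univ k), mul_zero]
    rw [key k hk, if_neg]
    intro hall
    have := hall (Fin.castLE hrN (τ s k)) (List.mem_ofFn.2 ⟨s, rfl⟩)
    exact hs (Fin.castLE_injective hrN this)
  · simp

theorem pderivList_replicate_mul {h : ℝ → ℝ} (hh : ContDiff ℝ (⊤ : ℕ∞) h) {Φ : Euc N → ℝ}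
    (hΦ : Differentiable ℝ Φ) (i : Fin N) (hΦi : ∀ x, pderiv' i Φ x = 0) (j : ℕ) :
    pderivList (List.replicate j i) (fun y => h (y i) * Φ y) =
      fun y => iteratedDeriv j h (y i) * Φ y := by
  induction j with
  | zero => simp [pderivList]
  | succ j ih =>
    simp only [List.replicate_succ, pderivList, ih]
    have hd : Differentiable ℝ (iteratedDeriv j h) :=
      hh.differentiable_iteratedDeriv _ (by exact_mod_cast ENat.natCast_lt_top _)
    have hd' : Differentiable ℝ fun y : Euc N => iteratedDeriv j h (y i) := by fun_prop
    funext y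
    have h1 := congrFun (pderiv_comp_apply hd i i) y
    have h2 := hΦi y
    simp only [pderiv'] at h1 h2 ⊢
    rw [fderiv_fun_mul (hd' y) (hΦ y)]
    simp [h1, h2, iteratedDeriv_succ, mul_comm]

theorem pderivList_const_mul (c : ℝ) {f : Euc N → ℝ} (hf : ContDiff ℝ (⊤ : ℕ∞) f)
    (L : List (Fin N)) : pderivList L (fun y => c * f y) = fun y => c * pderivList L f y := by
  induction L with
  | nil => rfl
  | cons i L ih =>
    funext y
    simp only [pderivList, ih, pderiv']
    rw [fderiv_const_mul ((contDiff_pderivList hf L).differentiable (by simp) y)]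
    simp

theorem hasCompactSupport_pderivList {f : Euc N → ℝ} (hf : HasCompactSupport f)
    (L : List (Fin N)) : HasCompactSupport (pderivList L f) := by
  induction L with
  | nil => exact hf
  | cons i L ih => exact ih.fderiv_apply (𝕜 := ℝ) _

theorem integral_pderivList_mul_pow {f : Euc N → ℝ} (hf : ContDiff ℝ (⊤ : ℕ∞) f)
    (hs : HasCompactSupport f) (i : Fin N) (j : ℕ) :
    ∫ x, pderivList (List.replicate j i) f x * x i ^ j = (-1) ^ j * (j.factorial : ℝ) * ∫ x, f x := by
  induction j with
  | zero => simp [pderivList]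
  | succ j ih =>
    set g := pderivList (List.replicate j i) f with hg
    have hgc : ContDiff ℝ (⊤ : ℕ∞) g := contDiff_pderivList hf _
    have hgs : HasCompactSupport g := hasCompactSupport_pderivList hs _
    have hg' : ContDiff ℝ (⊤ : ℕ∞) (fun x => fderiv ℝ g x (EuclideanSpace.single i 1)) :=
      contDiff_pderivList (hf) (i :: List.replicate j i)
    have hgs' : HasCompactSupport (fun x => fderiv ℝ g x (EuclideanSpace.single i 1)) :=
      hasCompactSupport_pderivList hs (i :: List.replicate j i)
    have hP : ∀ x : Euc N, fderiv ℝ (fun y : Euc N => y i ^ (j + 1)) x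
        (EuclideanSpace.single i 1) = ((j : ℝ) + 1) * x i ^ j := fun x => by
      have := congrFun (pderiv_comp_apply (h := fun t => t ^ (j + 1)) (by fun_prop) i i) x
      simpa [pderiv'] using this
    have hI : ∀ {a b : Euc N → ℝ}, Continuous a → HasCompactSupport a → Continuous b →
        Integrable (fun x => a x * b x) := fun ha hs hb =>
      (ha.mul hb).integrable_of_hasCompactSupport hs.mul_right
    have hib := integral_mul_fderiv_eq_neg_fderiv_mul_of_integrable (μ := volume)
      (f := fun y : Euc N => y i ^ (j + 1)) (g := g) (v := EuclideanSpace.single i 1)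
      (by
        simp only [hP]
        refine (hI hgc.continuous hgs (b := fun x => ((j : ℝ) + 1) * x i ^ j)
          (by fun_prop)).congr (Eventually.of_forall fun x => mul_comm _ _))
      ((hI hg'.continuous hgs' (b := fun x => x i ^ (j + 1))
          (by fun_prop)).congr (Eventually.of_forall fun x => mul_comm _ _))
      ((hI hgc.continuous hgs (b := fun x => x i ^ (j + 1))
          (by fun_prop)).congr (Eventually.of_forall fun x => mul_comm _ _))
      (fun x _ => by fun_prop) (fun x _ => hgc.differentiable (by simp) x)
    calc ∫ x, pderivList (List.replicate (j + 1) i) f x * x i ^ (j + 1)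
        = ∫ x, x i ^ (j + 1) * fderiv ℝ g x (EuclideanSpace.single i 1) := by
          refine integral_congr_ae (Eventually.of_forall fun x => ?_)
          simp only [List.replicate_succ, pderivList, pderiv', ← hg]
          ring
      _ = -∫ x, ((j : ℝ) + 1) * (g x * x i ^ j) := by
          rw [hib]
          congr 1
          refine integral_congr_ae (Eventually.of_forall fun x => ?_)
          simp only [hP]
          ring
      _ = _ := by
          rw [integral_const_mul, ih, Nat.factorial_succ]
          push_cast
          ring

end Minor

section Construction

variable {N n m r : ℕ}

/-- Extend a family of `r` scalar functions by zero to a map with `n` components. -/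
def extendComp (n : ℕ) (f : Fin r → Euc N → ℝ) (x : Euc N) (i : Fin n) : ℝ :=
  if h : (i : ℕ) < r then f ⟨i, h⟩ x else 0

@[simp]
theorem extendComp_castLE (hrn : r ≤ n) (f : Fin r → Euc N → ℝ) (x : Euc N) (j : Fin r) :
    extendComp n f x (Fin.castLE hrn j) = f j x := by
  simp [extendComp]

theorem IsOsc.extendComp {f : ℕ → Fin r → Euc N → ℝ} (hf : ∀ j, IsOsc fun k => f k j) :
    IsOsc fun k => extendComp n (f k) := by
  refine IsOsc.pi fun i => ?_
  by_cases h : (i : ℕ) < r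
  · simpa [_root_.extendComp, h] using hf ⟨i, h⟩
  · simp only [_root_.extendComp, h, dite_false]
    exact IsOsc.const contDiff_const HasCompactSupport.zero

theorem exists_of_isOsc (hN : 1 ≤ N) (hr0 : 0 < r) (hrn : r ≤ n) (hrN : r ≤ N)
    {Ω : Set (Euc N)} (hΩ : IsOpen Ω) (hΩb : Bornology.IsBounded Ω)
    {f : ℕ → Fin r → Euc N → ℝ} (hf : ∀ j, IsOsc fun k => f k j)
    {E : ℕ → Set (Euc N)} (hE : ∀ k, IsClosed (E k)) (hfE : ∀ k j x, x ∉ E k → f k j x = 0)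
    {V d s p c : ℝ} (hV : 0 ≤ V)
    (hvol : ∀ k : ℕ, volume (E k ∩ Ω) ≤ ENNReal.ofReal (V * ((k : ℝ) + 1) ^ (-d)))
    (hp : 0 < p) (hs : 0 < s) (hsd : s - m + (m : ℝ) / r < d / p - d / r) (hc : 0 < c)
    {ψ : Euc N → ℝ} (hψ : IsCinfc Ω ψ)
    (hM : ∀ (k : ℕ) (a : ℝ), c * ((k : ℝ) + 1) ^ ((m : ℝ) * r - m - a * r - d) ≤
      ∫ x in Ω, jacMinor m r (Fin.castLE hrn) (fun _ => Fin.castLE hrN)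
        (fun x => ((k : ℝ) + 1) ^ (-a) • extendComp n (f k) x) x * ψ x) :
    ∃ (u : ℕ → Euc N → Fin n → ℝ) (β : Fin r → Fin n)
      (α : Fin m → Fin r → Fin N) (ψ : Euc N → ℝ),
      (∀ k, ContDiffOn ℝ m (u k) (closure Ω)) ∧
      StrictMono β ∧ (∀ j, StrictMono (α j)) ∧ IsCinfc Ω ψ ∧
      Tendsto (fun k => sobNorm Ω s p (u k)) atTop (𝓝 0) ∧
      Tendsto (fun k => ∫ x in Ω, jacMinor m r β α (u k) x * ψ x) atTop atTop := by
  have hr : (0 : ℝ) < r := by exact_mod_cast hr0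
  obtain ⟨a, ha1, ha2⟩ : ∃ a, s - d / p < a ∧ a < m - (m : ℝ) / r - d / r :=
    exists_between (by linarith)
  have hexp : 0 < (m : ℝ) * r - m - a * r - d := by
    have h1 := mul_lt_mul_of_pos_right ha2 hr
    have h2 : ((m : ℝ) - (m : ℝ) / r - d / r) * r = m * r - m - d := by field_simp
    linarith
  have hosc : IsOsc fun k => extendComp n (f k) := IsOsc.extendComp hf
  refine ⟨fun k x => ((k : ℝ) + 1) ^ (-a) • extendComp n (f k) x, Fin.castLE hrn,
    fun _ => Fin.castLE hrN, ψ, fun k => ?_, Fin.strictMono_castLE hrn,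
    fun _ => Fin.strictMono_castLE hrN, hψ, ?_, ?_⟩
  · exact (((hosc.1 k).const_smul _).of_le (by exact_mod_cast le_top)).contDiffOn
  · refine hosc.tendsto_sobNorm hN hΩ hΩb hE (fun k x hx => ?_) hV hvol hp hs (by linarith)
    funext i
    by_cases h : (i : ℕ) < r
    · simp [extendComp, h, hfE k _ x hx]
    · simp [extendComp, h]
  · refine tendsto_atTop_mono (fun k => hM k a) (Tendsto.const_mul_atTop hc ?_)
    exact (tendsto_rpow_atTop hexp).comp
      (tendsto_atTop_add_const_right _ _ tendsto_natCast_atTop_atTop)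

theorem iteratedDeriv_mul_sin (A K c : ℝ) (j : ℕ) :
    iteratedDeriv j (fun t => A * Real.sin (K * t - c)) =
      fun t => A * K ^ j * Real.sin (K * t - c + j * (π / 2)) := by
  induction j with
  | zero => simp
  | succ j ih =>
    rw [iteratedDeriv_succ, ih]
    funext t
    have h1 : HasDerivAt (fun t => K * t - c + j * (π / 2)) K t := by
      simpa using (((hasDerivAt_id t).const_mul K).sub_const c).add_const (j * (π / 2))
    have h2 := (h1.sin.const_mul (A * K ^ j)).deriv
    rw [h2]
    push_cast
    rw [show K * t - c + (j + 1) * (π / 2) = (K * t - c + j * (π / 2)) + π / 2 by ring,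
      Real.sin_add_pi_div_two]
    ring

theorem iteratedDeriv_mul_mul_pow (A K : ℝ) (j : ℕ) (t : ℝ) :
    iteratedDeriv j (fun t => A * (K * t) ^ j) t = A * K ^ j * j.factorial := by
  have : (fun t : ℝ => A * (K * t) ^ j) = fun t => (A * K ^ j) * t ^ j := by
    funext t
    ring
  rw [this, iteratedDeriv_const_mul_field, iteratedDeriv_pow,
    Nat.descFactorial_self]
  simp

theorem integral_sin_sq_nat (k : ℕ) :
    ∫ t in (0 : ℝ)..(2 * π), Real.sin (((k : ℝ) + 1) * t) ^ 2 = π := by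
  have hK : (k : ℝ) + 1 ≠ 0 := by positivity
  rw [intervalIntegral.integral_comp_mul_left (fun t => Real.sin t ^ 2) hK, integral_sin_sq]
  have : Real.sin (((k : ℝ) + 1) * (2 * π)) = 0 := by
    have := Real.sin_nat_mul_pi (2 * (k + 1))
    push_cast at this
    rw [← this]
    congr 1
    ring
  rw [this]
  simp
  field_simp

theorem exists_concentrating (hN : 1 ≤ N) (hr0 : 0 < r) (hrn : r ≤ n) (hrN : r ≤ N)
    {Ω : Set (Euc N)} (hbox : {x : Euc N | ∀ i, |x i| < 8} ⊆ Ω) :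
    ∃ (f : ℕ → Fin r → Euc N → ℝ) (E : ℕ → Set (Euc N)) (V c : ℝ) (ψ : Euc N → ℝ),
      (∀ j, IsOsc fun k => f k j) ∧ (∀ k, IsClosed (E k)) ∧
      (∀ k j x, x ∉ E k → f k j x = 0) ∧ 0 ≤ V ∧
      (∀ k : ℕ, volume (E k ∩ Ω) ≤ ENNReal.ofReal (V * ((k : ℝ) + 1) ^ (-(N : ℝ)))) ∧
      0 < c ∧ IsCinfc Ω ψ ∧
      ∀ (k : ℕ) (a : ℝ), c * ((k : ℝ) + 1) ^ ((m : ℝ) * r - m - a * r - N) ≤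
        ∫ x in Ω, jacMinor m r (Fin.castLE hrn) (fun _ => Fin.castLE hrN)
          (fun x => ((k : ℝ) + 1) ^ (-a) • extendComp n (f k) x) x * ψ x := by
  have : Nonempty (Fin N) := ⟨⟨0, hN⟩⟩
  have hK : ∀ k : ℕ, (0 : ℝ) < (k : ℝ) + 1 := fun k => by positivity
  let l : Fin r := ⟨0, hr0⟩
  let l' : Fin N := Fin.castLE hrN l
  let w : ContDiffBump (0 : Euc N) := ⟨1 / 2, 1, by norm_num, by norm_num⟩
  let η : ContDiffBump (0 : Euc N) := ⟨1, 2, by norm_num, by norm_num⟩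
  let χ : ContDiffBump (0 : Euc N) := ⟨2, 3, by norm_num, by norm_num⟩
  let F : Fin r → Euc N → ℝ := fun j x => if j = l then w x else χ x * x (Fin.castLE hrN j) ^ m
  have hFs : ∀ j, ContDiff ℝ (⊤ : ℕ∞) (F j) := fun j => by
    by_cases hj : j = l
    · simpa [F, hj] using w.contDiff
    · simpa [F, hj] using χ.contDiff.mul (by fun_prop)
  have hFc : ∀ j, HasCompactSupport (F j) := fun j => by
    by_cases hj : j = l
    · simpa [F, hj] using w.hasCompactSupport
    · simp only [F, hj, if_false]
      exact χ.hasCompactSupport.mul_right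
  have hF0 : ∀ j x, 3 < ‖x‖ → F j x = 0 := fun j x hx => by
    by_cases hj : j = l
    · have : w x = 0 := w.zero_of_le_dist (by simp only [dist_zero_right, w]; linarith)
      simp [F, hj, this]
    · have : χ x = 0 := χ.zero_of_le_dist (by simp only [dist_zero_right, χ]; linarith)
      simp [F, hj, this]
  let f : ℕ → Fin r → Euc N → ℝ := fun k j x => F j (((k : ℝ) + 1) • x)
  let ψ : Euc N → ℝ := fun x => (-1) ^ m * (η x * x l' ^ m)
  have hψt : tsupport ψ ⊆ Metric.closedBall 0 2 := by
    refine closure_minimal (fun x hx => ?_) Metric.isClosed_closedBall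
    by_contra hcon
    have : η x = 0 := η.zero_of_le_dist (le_of_lt (by simpa [η] using hcon))
    exact hx (by simp [ψ, this])
  have hψ : IsCinfc Ω ψ := by
    refine ⟨contDiff_const.mul (η.contDiff.mul (by fun_prop)),
      (η.hasCompactSupport.mul_right).mul_left, fun x hx => hbox fun i => ?_⟩
    have h1 : ‖x‖ ≤ 2 := by simpa using hψt hx
    have h2 := PiLp.norm_apply_le x i
    rw [Real.norm_eq_abs] at h2
    linarith
  have hw : 0 < ∫ x, w x := w.integral_pos
  refine ⟨f, fun k => Metric.closedBall 0 (3 / ((k : ℝ) + 1)),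
    (volume (Metric.closedBall (0 : Euc N) 3)).toReal, (m.factorial : ℝ) ^ r * ∫ x, w x, ψ,
    fun j => ?_, fun k => Metric.isClosed_closedBall, fun k j x hx => ?_, ENNReal.toReal_nonneg,
    fun k => ?_, by positivity, hψ, fun k a => ?_⟩
  · exact IsOsc.comp_smul (hFs j) (bounded_iteratedFDeriv (hFs j) (hFc j))
      (ContinuousLinearMap.id ℝ (Euc N))
  · refine hF0 j _ ?_
    rw [norm_smul, Real.norm_of_nonneg (hK k).le]
    simp only [Metric.mem_closedBall, dist_zero_right, not_le] at hx
    rw [div_lt_iff₀ (hK k)] at hx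
    linarith
  · refine (measure_mono Set.inter_subset_left).trans_eq ?_
    have h1 := Measure.addHaar_closedBall_mul volume (0 : Euc N)
      (r := ((k : ℝ) + 1)⁻¹) (by positivity) (s := 3) (by norm_num)
    beta_reduce
    rw [show 3 / ((k : ℝ) + 1) = ((k : ℝ) + 1)⁻¹ * 3 by ring, h1, mul_comm,
      ENNReal.ofReal_mul ENNReal.toReal_nonneg,
      ENNReal.ofReal_toReal (measure_closedBall_lt_top).ne,
      Real.rpow_neg (hK k).le, Real.rpow_natCast]
    simp
  · set K : ℝ := (k : ℝ) + 1 with hKdef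
    have hK0 : 0 < K := hK k
    have hK1 : 1 ≤ K := by simp [hKdef]
    let wK : Euc N → ℝ := fun x => w (K • x)
    have hwK : ContDiff ℝ (⊤ : ℕ∞) wK := w.contDiff.comp (by fun_prop)
    have hwKc : HasCompactSupport wK := w.hasCompactSupport.comp_smul hK0.ne'
    let P : Euc N → ℝ := pderivList (List.replicate m l') wK
    let c₁ : ℝ := (K ^ (-a) * K ^ m * m.factorial) ^ (r - 1) * K ^ (-a)
    have hfar : ∀ x : Euc N, 1 < ‖K • x‖ → wK =ᶠ[𝓝 x] fun _ => 0 := fun x hx => by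
      have : ∀ᶠ y in 𝓝 x, 1 < ‖K • y‖ :=
        ContinuousAt.eventually_lt continuousAt_const (by fun_prop) hx
      filter_upwards [this] with y hy
      exact w.zero_of_le_dist (by simpa [w] using hy.le)
    have hP0 : ∀ x : Euc N, 1 < ‖K • x‖ → P x = 0 := fun x hx => by
      simp only [P]
      rw [(pderivList_congr (hfar x hx) _).eq_of_nhds, pderivList_zero]
    have hul : (fun y => (K ^ (-a) • extendComp n (f k) y) (Fin.castLE hrn l)) =
        fun y => K ^ (-a) * wK y := by
      funext y
      simp [f, F, wK, ← hKdef]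
    have hJ : ∀ x, jacMinor m r (Fin.castLE hrn) (fun _ => Fin.castLE hrN)
        (fun x => K ^ (-a) • extendComp n (f k) x) x = c₁ * P x := by
      intro x
      by_cases hx : 1 < ‖K • x‖
      · rw [hP0 x hx, mul_zero]
        refine jacMinor_eq_zero _ _ l ?_
        rw [hul]
        filter_upwards [hfar x hx] with y hy
        simp [hy]
      · have hnear : ∀ᶠ y in 𝓝 x, ‖K • y‖ < 2 :=
          ContinuousAt.eventually_lt (by fun_prop) continuousAt_const (by linarith)
        rw [jacMinor_eq_prod hrN (Fin.castLE hrn) l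
          (g := fun _ t => K ^ (-a) * (K * t) ^ m) (fun _ => by fun_prop), hul,
          pderivList_const_mul _ hwK]
        · simp only [iteratedDeriv_mul_mul_pow]
          rw [Finset.prod_const, Finset.card_erase_of_mem (Finset.mem_univ _), Finset.card_univ,
            Fintype.card_fin]
          simp only [c₁, P, l']
          ring
        · intro j hj
          filter_upwards [hnear] with y hy
          have h1 : χ (K • y) = 1 := χ.one_of_mem_closedBall (by simpa [χ] using hy.le)
          simp [f, F, hj, ← hKdef, h1]
    have hint : ∀ x, jacMinor m r (Fin.castLE hrn) (fun _ => Fin.castLE hrN)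
        (fun x => K ^ (-a) • extendComp n (f k) x) x * ψ x =
          (c₁ * (-1) ^ m) * (P x * x l' ^ m) := by
      intro x
      rw [hJ x]
      by_cases hx : 1 < ‖K • x‖
      · simp [hP0 x hx]
      · have h1 : ‖x‖ ≤ 1 := by
          rw [norm_smul, Real.norm_of_nonneg hK0.le, not_lt] at hx
          nlinarith [norm_nonneg x]
        have h2 : η x = 1 := η.one_of_mem_closedBall (by simpa [η] using h1)
        simp only [ψ, h2]
        ring
    rw [setIntegral_eq_integral_of_forall_compl_eq_zero]
    swap
    · intro x hx
      rw [image_eq_zero_of_notMem_tsupport (fun h => hx (hψ.2.2 h)), mul_zero]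
    simp only [hint]
    rw [integral_const_mul, integral_pderivList_mul_pow hwK hwKc]
    have h3 : ∫ x, wK x = (K ^ N)⁻¹ * ∫ x, w x := by
      simp only [wK]
      rw [Measure.integral_comp_smul]
      simp [abs_of_pos hK0]
    rw [h3]
    refine le_of_eq ?_
    obtain ⟨q, rfl⟩ : ∃ q, r = q + 1 := ⟨r - 1, by omega⟩
    have h4 : K ^ ((m : ℝ) * ((q + 1 : ℕ) : ℝ) - m - a * ((q + 1 : ℕ) : ℝ) - N) =
        (K ^ (-a) * K ^ m) ^ q * K ^ (-a) * (K ^ N)⁻¹ := by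
      rw [← Real.rpow_natCast K m, ← Real.rpow_add hK0, ← Real.rpow_natCast _ q,
        ← Real.rpow_mul hK0.le, ← Real.rpow_add hK0, ← Real.rpow_natCast K N,
        ← Real.rpow_neg hK0.le, ← Real.rpow_add hK0]
      congr 1
      push_cast
      ring
    rw [h4]
    simp only [c₁, Nat.add_sub_cancel]
    rw [mul_pow _ (m.factorial : ℝ)]
    have h5 : ((-1 : ℝ) ^ m) * (-1) ^ m = 1 := by
      rw [← mul_pow]
      simp
    linear_combination (-(((K ^ (-a) * K ^ m) ^ q * (m.factorial : ℝ) ^ q * K ^ (-a)) *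
      (m.factorial * ((K ^ N)⁻¹ * ∫ x, w x)))) * h5

theorem exists_product_cutoff {Ω : Set (Euc N)} (hΩb : Bornology.IsBounded Ω)
    (hbox : {x : Euc N | ∀ i, |x i| < 8} ⊆ Ω) :
    ∃ ψ : Euc N → ℝ, IsCinfc Ω ψ ∧ (∀ x, 0 ≤ ψ x) ∧ ∀ x, (∀ i, |x i| ≤ 7) → ψ x = 1 := by
  let b : ContDiffBump (0 : ℝ) := ⟨7, 15 / 2, by norm_num, by norm_num⟩
  have hsub : tsupport (fun x : Euc N => ∏ i, b (x i)) ⊆ Ω := by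
    refine (closure_minimal (t := {x : Euc N | ∀ i, |x i| ≤ 15 / 2}) ?_ ?_).trans ?_
    · intro x hx i
      by_contra hcon
      have : b (x i) = 0 := b.zero_of_le_dist (by simpa [b] using (not_le.1 hcon).le)
      exact hx (Finset.prod_eq_zero (Finset.mem_univ i) this)
    · rw [Set.ofPred_forall]
      exact isClosed_iInter fun i => isClosed_le (by fun_prop) continuous_const
    · intro x hx
      exact hbox fun i => (hx i).trans_lt (by norm_num)
  refine ⟨fun x => ∏ i, b (x i), ⟨contDiff_prod fun i _ => b.contDiff.comp (by fun_prop), ?_,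
    hsub⟩, fun x => Finset.prod_nonneg fun i _ => b.nonneg, fun x hx => ?_⟩
  · exact Metric.isCompact_of_isClosed_isBounded (isClosed_tsupport _) (hΩb.subset hsub)
  · exact Finset.prod_eq_one fun i _ => b.one_of_mem_closedBall (by simpa [b] using hx i)

theorem one_le_integral_sin_sq_mul {ψ : Euc N → ℝ} (hψ : Continuous ψ)
    (hψc : HasCompactSupport ψ) (h0 : ∀ x, 0 ≤ ψ x) (h1 : ∀ x, (∀ i, |x i| ≤ 7) → ψ x = 1)
    (S : Finset (Fin N)) (k : ℕ) :
    1 ≤ ∫ x, (∏ i ∈ S, Real.sin (((k : ℝ) + 1) * x i) ^ 2) * ψ x := by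
  let g : Fin N → ℝ → ℝ := fun i => (Set.Ioc 0 (2 * π)).indicator
    fun t => if i ∈ S then Real.sin (((k : ℝ) + 1) * t) ^ 2 else 1
  have hg0 : ∀ i t, 0 ≤ g i t := fun i t => by
    refine Set.indicator_nonneg (fun t _ => ?_) t
    split_ifs <;> positivity
  have hg1 : ∀ i, 1 ≤ ∫ t, g i t := fun i => by
    simp only [g]
    rw [integral_indicator measurableSet_Ioc,
      ← intervalIntegral.integral_of_le (by positivity)]
    by_cases hi : i ∈ S
    · simp only [hi, if_true]
      rw [integral_sin_sq_nat]
      linarith [Real.pi_gt_three]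
    · simp only [hi, if_false]
      simp
      linarith [Real.pi_gt_three]
  have hint : ∫ x : Euc N, ∏ i, g i (x i) = ∏ i, ∫ t, g i t := by
    rw [← integral_fintype_prod_volume_eq_prod,
      ← (PiLp.volume_preserving_toLp (Fin N)).integral_comp
        (MeasurableEquiv.toLp 2 (Fin N → ℝ)).measurableEmbedding]
  calc (1 : ℝ) = ∏ _i : Fin N, (1 : ℝ) := by simp
    _ ≤ ∏ i, ∫ t, g i t := Finset.prod_le_prod (fun _ _ => zero_le_one) fun i _ => hg1 i
    _ = ∫ x : Euc N, ∏ i, g i (x i) := hint.symm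
    _ ≤ _ := by
      refine integral_mono_of_nonneg
        (Eventually.of_forall fun x => Finset.prod_nonneg fun i _ => hg0 i _) ?_
        (Eventually.of_forall fun x => ?_)
      · exact (Continuous.mul (by fun_prop) hψ).integrable_of_hasCompactSupport hψc.mul_left
      · by_cases hx : ∀ i, x i ∈ Set.Ioc 0 (2 * π)
        · have h2 : ψ x = 1 := h1 x fun i => by
            have := hx i
            rw [abs_of_pos this.1]
            linarith [this.2, Real.pi_lt_d2]
          simp only [h2, mul_one, g]
          refine le_of_eq ?_
          rw [Finset.prod_congr rfl fun i _ => Set.indicator_of_mem (hx i) _,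
            Finset.prod_ite_mem, Finset.univ_inter]
        · push Not at hx
          obtain ⟨i, hi⟩ := hx
          have : ∏ i, g i (x i) = 0 :=
            Finset.prod_eq_zero (Finset.mem_univ i) (Set.indicator_of_notMem hi _)
          simp only [this]
          exact mul_nonneg (Finset.prod_nonneg fun i _ => by positivity) (h0 x)

theorem isOsc_sin (c : ℝ) (i : Fin N) :
    IsOsc fun (k : ℕ) (x : Euc N) => Real.sin (((k : ℝ) + 1) * x i - c) := by
  have h1 : ∀ j, iteratedDeriv j (fun t => Real.sin (t - c)) =
      fun t => Real.sin (t - c + j * (π / 2)) := fun j => by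
    simpa using iteratedDeriv_mul_sin 1 1 c j
  refine IsOsc.comp_smul (f := fun t => Real.sin (t - c)) (by fun_prop) (fun j => ⟨1, fun t => ?_⟩)
    (EuclideanSpace.proj i)
  rw [norm_iteratedFDeriv_eq_norm_iteratedDeriv, h1]
  exact Real.abs_sin_le_one _

theorem exists_oscillating (hr0 : 0 < r) (hrn : r ≤ n) (hrN : r ≤ N)
    {Ω : Set (Euc N)} (hΩb : Bornology.IsBounded Ω)
    (hbox : {x : Euc N | ∀ i, |x i| < 8} ⊆ Ω) :
    ∃ (f : ℕ → Fin r → Euc N → ℝ) (c : ℝ) (ψ : Euc N → ℝ),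
      (∀ j, IsOsc fun k => f k j) ∧ 0 < c ∧ IsCinfc Ω ψ ∧
      ∀ (k : ℕ) (a : ℝ), c * ((k : ℝ) + 1) ^ ((m : ℝ) * r - m - a * r) ≤
        ∫ x in Ω, jacMinor m r (Fin.castLE hrn) (fun _ => Fin.castLE hrN)
          (fun x => ((k : ℝ) + 1) ^ (-a) • extendComp n (f k) x) x * ψ x := by
  have hK : ∀ k : ℕ, (0 : ℝ) < (k : ℝ) + 1 := fun k => by positivity
  let l : Fin r := ⟨0, hr0⟩
  let l' : Fin N := Fin.castLE hrN l
  obtain ⟨ψ, hψ, hψ0, hψ1⟩ := exists_product_cutoff hΩb hbox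
  obtain ⟨R, hR0, hR⟩ := hΩb.exists_pos_norm_lt
  let χ : ContDiffBump (0 : Euc N) := ⟨R, R + 1, hR0, by linarith⟩
  let S : Finset (Fin N) := (Finset.univ.erase l).image (Fin.castLE hrN)
  have hlS : l' ∉ S := fun h => by
    obtain ⟨j, hj, hjl⟩ := Finset.mem_image.1 h
    exact Finset.ne_of_mem_erase hj (Fin.castLE_injective hrN hjl)
  have hprodS : ∀ q : Fin N → ℝ,
      ∏ j ∈ Finset.univ.erase l, q (Fin.castLE hrN j) = ∏ i ∈ S, q i := fun q =>
    (Finset.prod_image fun _ _ _ _ h => Fin.castLE_injective hrN h).symm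
  let f : ℕ → Fin r → Euc N → ℝ := fun k j x =>
    if j = l then (χ x * x l' ^ m) * ∏ i ∈ S, Real.sin (((k : ℝ) + 1) * x i - 0)
    else Real.sin (((k : ℝ) + 1) * x (Fin.castLE hrN j) - m * (π / 2))
  refine ⟨f, m.factorial, ψ, fun j => ?_, by positivity, hψ, fun k a => ?_⟩
  · by_cases hj : j = l
    · simp only [f, hj, if_true]
      exact (IsOsc.const (χ.contDiff.mul (by fun_prop)) χ.hasCompactSupport.mul_right).mul
        (IsOsc.prod S fun i _ => isOsc_sin 0 i)
    · simp only [f, hj, if_false]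
      exact isOsc_sin _ _
  · set K : ℝ := (k : ℝ) + 1 with hKdef
    have hK0 : 0 < K := hK k
    let Φ : Euc N → ℝ := fun x => ∏ i ∈ S, Real.sin (K * x i)
    have hΦd : Differentiable ℝ Φ := by fun_prop
    have hΦl : ∀ x, pderiv' l' Φ x = 0 := fun x => by
      have h1 : HasFDerivAt Φ _ x := HasFDerivAt.finsetProd
        (g := fun i (y : Euc N) => Real.sin (K * y i)) fun i _ =>
          (show DifferentiableAt ℝ (fun y : Euc N => Real.sin (K * y i)) x by
            fun_prop).hasFDerivAt
      rw [pderiv', h1.fderiv]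
      simp only [sum_apply, smul_apply]
      refine Finset.sum_eq_zero fun i hi => ?_
      have h2 := congrFun (pderiv_comp_apply (h := fun t => Real.sin (K * t)) (by fun_prop) l' i) x
      have hne : l' ≠ i := fun h => hlS (by rw [h]; exact hi)
      rw [if_neg hne] at h2
      simp only [pderiv'] at h2
      rw [h2, smul_zero]
    have hJ : ∀ x ∈ Ω, jacMinor m r (Fin.castLE hrn) (fun _ => Fin.castLE hrN)
        (fun x => K ^ (-a) • extendComp n (f k) x) x =
          ((K ^ (-a) * K ^ m) ^ (r - 1) * (K ^ (-a) * m.factorial)) *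
            ∏ i ∈ S, Real.sin (K * x i) ^ 2 := by
      intro x hx
      have hnear : ∀ᶠ y in 𝓝 x, ‖y‖ < R :=
        ContinuousAt.eventually_lt (by fun_prop) continuousAt_const (hR x hx)
      have hul : (fun y => (K ^ (-a) • extendComp n (f k) y) (Fin.castLE hrn l)) =ᶠ[𝓝 x]
          fun y => (K ^ (-a) * (1 * y l') ^ m) * Φ y := by
        filter_upwards [hnear] with y hy
        have h1 : χ y = 1 := χ.one_of_mem_closedBall (by simpa [χ] using hy.le)
        simp [f, Φ, ← hKdef, h1]
        ring
      rw [jacMinor_eq_prod hrN (Fin.castLE hrn) l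
        (g := fun _ t => K ^ (-a) * Real.sin (K * t - m * (π / 2))) (fun _ => by fun_prop),
        (pderivList_congr hul _).eq_of_nhds,
        pderivList_replicate_mul (h := fun t => K ^ (-a) * (1 * t) ^ m) (by fun_prop) hΦd _ hΦl]
      · simp only [iteratedDeriv_mul_mul_pow, iteratedDeriv_mul_sin, sub_add_cancel]
        rw [Finset.prod_mul_distrib, Finset.prod_const,
          Finset.card_erase_of_mem (Finset.mem_univ _), Finset.card_univ, Fintype.card_fin,
          hprodS fun i => Real.sin (K * x i), Finset.prod_pow]
        simp only [Φ]
        ring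
      · intro j hj
        refine Eventually.of_forall fun y => ?_
        simp [f, hj, ← hKdef]
    have hint : ∀ x, jacMinor m r (Fin.castLE hrn) (fun _ => Fin.castLE hrN)
        (fun x => K ^ (-a) • extendComp n (f k) x) x * ψ x =
          ((K ^ (-a) * K ^ m) ^ (r - 1) * (K ^ (-a) * m.factorial)) *
            ((∏ i ∈ S, Real.sin (K * x i) ^ 2) * ψ x) := by
      intro x
      by_cases hx : x ∈ Ω
      · rw [hJ x hx]
        ring
      · rw [image_eq_zero_of_notMem_tsupport (fun h => hx (hψ.2.2 h))]
        simp
    rw [setIntegral_eq_integral_of_forall_compl_eq_zero]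
    swap
    · intro x hx
      rw [image_eq_zero_of_notMem_tsupport (fun h => hx (hψ.2.2 h)), mul_zero]
    simp only [hint]
    rw [integral_const_mul]
    have h1 := one_le_integral_sin_sq_mul hψ.1.continuous hψ.2.1 hψ0 hψ1 S k
    rw [← hKdef] at h1
    have h2 : 0 ≤ (K ^ (-a) * K ^ m) ^ (r - 1) * (K ^ (-a) * m.factorial) := by positivity
    refine le_trans (le_of_eq ?_) (le_mul_of_one_le_right h2 h1)
    obtain ⟨q, rfl⟩ : ∃ q, r = q + 1 := ⟨r - 1, by omega⟩
    have h4 : K ^ ((m : ℝ) * ((q + 1 : ℕ) : ℝ) - m - a * ((q + 1 : ℕ) : ℝ)) =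
        (K ^ (-a) * K ^ m) ^ q * K ^ (-a) := by
      rw [← Real.rpow_natCast K m, ← Real.rpow_add hK0, ← Real.rpow_natCast _ q,
        ← Real.rpow_mul hK0.le, ← Real.rpow_add hK0]
      congr 1
      push_cast
      ring
    rw [h4, Nat.add_sub_cancel]
    ring

end Construction

/-- Theorem 1.2: if `W^{s,p} ⊄ W^{m-m/r,r}` (equivalently,
`s - m + m/r < max{0, N/p - N/r}` or (`p > r` and `s = m - m/r` non-integer)) and the
case (`1 < r < p`, `s = m - m/r` non-integer) fails, then there are
`u_k ∈ C^m(Ω̄,ℝ^n)`, minors `(β, α)` and `ψ ∈ C_c^∞(Ω)` with `‖u_k‖_{W^{s,p}} → 0` and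
`∫_Ω M^β_α(D^m u_k) ψ → ∞`. -/
theorem stmt14 (N n m r : ℕ) (hN : 2 ≤ N) (hn : 1 ≤ n) (hm : 1 ≤ m)
    (hr1 : 1 < r) (hr : r ≤ min n N)
    (Ω : Set (Euc N)) (hΩ : IsSmoothDomain Ω)
    (hbox : {x : Euc N | ∀ i, |x i| < 8} ⊆ Ω)
    (p s : ℝ) (hp1 : 1 < p) (hs0 : 0 < s)
    (hnotembed :
      s - m + (m : ℝ) / r < max 0 ((N : ℝ) / p - (N : ℝ) / r) ∨
        ((r : ℝ) < p ∧ s = (m : ℝ) - (m : ℝ) / r ∧ ¬∃ k : ℕ, s = k))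
    (hfail : ¬((r : ℝ) < p ∧ s = (m : ℝ) - (m : ℝ) / r ∧ ¬∃ k : ℕ, s = k)) :
    ∃ (u : ℕ → Euc N → Fin n → ℝ) (β : Fin r → Fin n)
      (α : Fin m → Fin r → Fin N) (ψ : Euc N → ℝ),
      (∀ k, ContDiffOn ℝ m (u k) (closure Ω)) ∧
      StrictMono β ∧ (∀ j, StrictMono (α j)) ∧ IsCinfc Ω ψ ∧
      Tendsto (fun k => sobNorm Ω s p (u k)) atTop (𝓝 0) ∧
      Tendsto (fun k => ∫ x in Ω, jacMinor m r β α (u k) x * ψ x) atTop atTop := by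
  have hrn : r ≤ n := hr.trans (min_le_left _ _)
  have hrN : r ≤ N := hr.trans (min_le_right _ _)
  have hp0 : 0 < p := by linarith
  have h := hnotembed.resolve_right hfail
  rcases lt_max_iff.1 h with h | h
  · obtain ⟨f, c, ψ, hf, hc, hψ, hM⟩ :=
      exists_oscillating (m := m) (by omega) hrn hrN hΩ.2.1 hbox
    refine exists_of_isOsc (d := 0) (E := fun _ => Set.univ) (V := (volume Ω).toReal)
      (by omega) (by omega) hrn hrN hΩ.1 hΩ.2.1 hf (fun _ => isClosed_univ)
      (fun _ _ x hx => absurd (Set.mem_univ x) hx) ENNReal.toReal_nonneg (fun k => ?_) hp0 hs0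
      (by simpa using h) hc hψ (fun k a => by simpa using hM k a)
    simp [ENNReal.ofReal_toReal hΩ.2.1.measure_lt_top.ne]
  · obtain ⟨f, E, V, c, ψ, hf, hE, hfE, hV, hvol, hc, hψ, hM⟩ :=
      exists_concentrating (m := m) (by omega) (by omega) hrn hrN hbox
    exact exists_of_isOsc (by omega) (by omega) hrn hrN hΩ.1 hΩ.2.1 hf hE hfE hV hvol hp0 hs0
      h hc hψ hM
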